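/- arXiv:1411.7717 — 2 statements merged into one kernel-verified Lean document; each statement's English description precedes it below -/
import Mathlib

section
/- Any graph with e edges contains at most (√(8e+1) − 3)·e/6 triangles; in particular, at most (√2/3)·e^{3/2} triangles. -/
namespace SimpleGraph

theorem IsNClique.exists_adj_of_mem_triangle {V : Type*} [DecidableEq V] {G : SimpleGraph V}
    {v : V} {T : Finset V}
    (hT : G.IsNClique 3 T) (hv : v ∈ T) :
    ∃ a b, G.Adj v a ∧ G.Adj v b ∧ G.Adj a b ∧ T = {v, a, b} := by
  obtain ⟨x, y, z, hxy, hxz, hyz, rfl⟩ := is3Clique_iff.1 hT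
  simp only [Finset.mem_insert, Finset.mem_singleton] at hv
  rcases hv with rfl | rfl | rfl
  · exact ⟨y, z, hxy, hxz, hyz, rfl⟩
  · exact ⟨x, z, hxy.symm, hyz, hxz, Finset.insert_comm _ _ _⟩
  · exact ⟨x, y, hxz.symm, hyz.symm, hxy, by ext; simp; tauto⟩

variable {V : Type*} [Fintype V] [DecidableEq V] (G : SimpleGraph V) [DecidableRel G.Adj]

theorem sum_card_triangles_through :
    ∑ v, ((G.cliqueFinset 3).filter (v ∈ ·)).card = 3 * (G.cliqueFinset 3).card := by
  have h := Finset.sum_card_bipartiteAbove_eq_sum_card_bipartiteBelow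
    (s := Finset.univ) (t := G.cliqueFinset 3) (fun (v : V) (T : Finset V) => v ∈ T)
  simp only [Finset.bipartiteAbove, Finset.bipartiteBelow, Finset.filter_univ_mem] at h
  rw [h, Finset.sum_congr rfl fun T hT => (G.mem_cliqueFinset_iff.1 hT).card_eq]
  simp [mul_comm]

theorem card_triangles_through_le_choose (v : V) :
    ((G.cliqueFinset 3).filter (v ∈ ·)).card ≤ (G.degree v).choose 2 := by
  rw [← card_neighborFinset_eq_degree, ← Finset.card_powersetCard]
  refine (Finset.card_le_card fun T hT => ?_).trans
    (Finset.card_image_le (f := fun S : Finset V => insert v S))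
  rw [Finset.mem_filter, mem_cliqueFinset_iff] at hT
  obtain ⟨a, b, hva, hvb, hab, rfl⟩ := hT.1.exists_adj_of_mem_triangle hT.2
  refine Finset.mem_image.2 ⟨{a, b}, Finset.mem_powersetCard.2 ⟨?_, Finset.card_pair hab.ne⟩, rfl⟩
  simp [Finset.insert_subset_iff, hva, hvb]

theorem card_triangles_through_add_degree_le (v : V) :
    ((G.cliqueFinset 3).filter (v ∈ ·)).card + G.degree v ≤ G.edgeFinset.card := by
  rw [← card_incidenceFinset_eq_degree, ← Finset.card_sdiff_add_card_eq_card
    (G.incidenceFinset_subset v)]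
  gcongr
  refine (Finset.card_le_card fun T hT => ?_).trans
    (Finset.card_image_le (f := fun e : Sym2 V => insert v e.toFinset))
  rw [Finset.mem_filter, mem_cliqueFinset_iff] at hT
  obtain ⟨a, b, hva, hvb, hab, rfl⟩ := hT.1.exists_adj_of_mem_triangle hT.2
  refine Finset.mem_image.2 ⟨s(a, b), ?_, by simp [Sym2.toFinset_mk_eq]⟩
  simp [mem_incidenceFinset, mk'_mem_incidenceSet_iff, hab, hva.ne, hvb.ne]

theorem card_triangles_through_le (v : V) :
    (((G.cliqueFinset 3).filter (v ∈ ·)).card : ℝ) ≤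
      G.degree v * ((Real.sqrt (8 * (G.edgeFinset.card : ℝ) + 1) - 3) / 4) := by
  have h₁ : (((G.cliqueFinset 3).filter (v ∈ ·)).card : ℝ) ≤ (G.degree v).choose 2 :=
    mod_cast G.card_triangles_through_le_choose v
  have h₂ : (((G.cliqueFinset 3).filter (v ∈ ·)).card : ℝ) + G.degree v ≤ G.edgeFinset.card :=
    mod_cast G.card_triangles_through_add_degree_le v
  rw [Nat.cast_choose_two] at h₁
  set s := Real.sqrt (8 * (G.edgeFinset.card : ℝ) + 1)
  have hs : s ^ 2 = 8 * (G.edgeFinset.card : ℝ) + 1 := Real.sq_sqrt (by positivity)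
  have hs₀ : 0 ≤ s := Real.sqrt_nonneg _
  have hd : (0 : ℝ) ≤ G.degree v := Nat.cast_nonneg _
  rcases le_total ((G.degree v : ℝ)) ((s - 1) / 2) with h | h
  · nlinarith [mul_le_mul_of_nonneg_left h hd]
  · nlinarith [mul_le_mul_of_nonneg_right h (by linarith : 0 ≤ s + 1)]

end SimpleGraph


/-- Fisher's bound: a simple graph with `e` edges has at most `(√(8e+1) − 3)·e/6` triangles;
in particular at most `(√2/3)·e^{3/2}` triangles. -/
theorem stmt_11 {V : Type*} [Fintype V] [DecidableEq V] (G : SimpleGraph V)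
    [DecidableRel G.Adj] :
    ((G.cliqueFinset 3).card : ℝ) ≤
        (Real.sqrt (8 * (G.edgeFinset.card : ℝ) + 1) - 3) * (G.edgeFinset.card : ℝ) / 6 ∧
      ((G.cliqueFinset 3).card : ℝ) ≤
        (Real.sqrt 2 / 3) * (G.edgeFinset.card : ℝ) ^ ((3 : ℝ) / 2) := by
  have hfst : ((G.cliqueFinset 3).card : ℝ) ≤
      (Real.sqrt (8 * (G.edgeFinset.card : ℝ) + 1) - 3) * (G.edgeFinset.card : ℝ) / 6 := by
    have h := Finset.sum_le_sum fun v (_ : v ∈ Finset.univ) => G.card_triangles_through_le v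
    rw [← Finset.sum_mul, ← Nat.cast_sum, ← Nat.cast_sum, G.sum_card_triangles_through,
      G.sum_degrees_eq_twice_card_edges] at h
    push_cast at h
    linarith
  refine ⟨hfst, hfst.trans ?_⟩
  have he : (0 : ℝ) ≤ G.edgeFinset.card := Nat.cast_nonneg _
  generalize (G.edgeFinset.card : ℝ) = e at he
  have hpow : e ^ ((3 : ℝ) / 2) = e * Real.sqrt e := by
    rw [Real.sqrt_eq_rpow, show (3 : ℝ) / 2 = 1 + 1 / 2 by norm_num,
      Real.rpow_add_of_nonneg he (by norm_num) (by norm_num), Real.rpow_one]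
  have hs : Real.sqrt (8 * e + 1) ≤ 2 * (Real.sqrt 2 * Real.sqrt e) + 3 := by
    rw [← Real.sqrt_mul zero_le_two]
    refine Real.sqrt_le_iff.2 ⟨by positivity, ?_⟩
    nlinarith [Real.sq_sqrt (mul_nonneg zero_le_two he), Real.sqrt_nonneg (2 * e)]
  rw [hpow]
  nlinarith [mul_le_mul_of_nonneg_right hs he]
end

section
/- Let m ≥ 20 and let the edges of K_m be 2-colored with between n/3 and 2n/3 red edges, n = C(m,2). Suppose g is a nonnegative function of the indicator variables of red edges and h is a nonnegative function of the indicator variables of blue edges, such that whenever the graph encoded by x is not a spanning tree of K_m, g·h evaluates to 0 at x. Then the fraction of spanning trees T of K_m with g(T)·h(T) > 0 is at most 2^{-m/15120}. -/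
/-- Edges of the complete graph `K_m`: ordered pairs of vertices. -/
abbrev KmEdge (m : ℕ) := {p : Fin m × Fin m // p.1 < p.2}

/-- The subgraph of `K_m` encoded by the edge-indicator vector `x`. -/
def graphOf {m : ℕ} (x : KmEdge m → Bool) : SimpleGraph (Fin m) :=
  SimpleGraph.fromRel (fun u v => ∃ h : u < v, x ⟨(u, v), h⟩ = true)

namespace SpanningTree

open Finset

variable {α : Type*}

/-- In `G` the vertex `v` has exactly one neighbour, and that neighbour lies in `W`. -/
def IsPendant (W : Finset α) (G : SimpleGraph α) (v : α) : Prop :=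
  ∃ w ∈ W, ∀ x, G.Adj v x ↔ x = w

/-- The graph obtained from a graph `H` off `S` by joining each `v ∈ S` to the single vertex
`f v ∈ W`. -/
def attach {S W : Finset α} (hSW : Disjoint S W) (H : SimpleGraph {x // x ∉ S})
    (f : {x // x ∈ S} → {x // x ∈ W}) : SimpleGraph α where
  Adj x y := (∃ (hx : x ∉ S) (hy : y ∉ S), H.Adj ⟨x, hx⟩ ⟨y, hy⟩) ∨
    (∃ hx : x ∈ S, (f ⟨x, hx⟩ : α) = y) ∨ ∃ hy : y ∈ S, (f ⟨y, hy⟩ : α) = x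
  symm := ⟨by
    rintro x y (⟨hx, hy, h⟩ | h | h)
    · exact Or.inl ⟨hy, hx, h.symm⟩
    · exact Or.inr (Or.inr h)
    · exact Or.inr (Or.inl h)⟩
  loopless := ⟨by
    rintro x (⟨hx, hy, h⟩ | ⟨h, h'⟩ | ⟨h, h'⟩)
    · exact h.ne rfl
    all_goals exact Finset.disjoint_left.1 hSW h (h' ▸ (f ⟨x, h⟩).2)⟩

variable {S W : Finset α} {hSW : Disjoint S W} {H : SimpleGraph {x // x ∉ S}}
  {f : {x // x ∈ S} → {x // x ∈ W}}

theorem attach_adj_of_mem {x y : α} (hx : x ∈ S) :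
    (attach hSW H f).Adj x y ↔ y = f ⟨x, hx⟩ := by
  constructor
  · rintro (⟨h, -⟩ | ⟨_, h⟩ | ⟨h, h'⟩)
    · exact absurd hx h
    · exact h.symm
    · exact absurd (h' ▸ (f ⟨y, h⟩).2) (Finset.disjoint_left.1 hSW hx)
  · rintro rfl
    exact Or.inr (Or.inl ⟨hx, rfl⟩)

theorem attach_adj_coe {x y : {x // x ∉ S}} : (attach hSW H f).Adj x y ↔ H.Adj x y := by
  constructor
  · rintro (⟨_, _, h⟩ | ⟨h, -⟩ | ⟨h, -⟩)
    · exact h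
    · exact absurd h x.2
    · exact absurd h y.2
  · exact fun h => Or.inl ⟨x.2, y.2, h⟩

theorem isPendant_attach {v : α} (hv : v ∈ S) : IsPendant W (attach hSW H f) v :=
  ⟨f ⟨v, hv⟩, (f ⟨v, hv⟩).2, fun _ => attach_adj_of_mem hv⟩

theorem attach_adj_of_not_mem {x y : α} (hx : x ∉ S) (hxW : x ∉ W) :
    (attach hSW H f).Adj x y ↔ ∃ hy : y ∉ S, H.Adj ⟨x, hx⟩ ⟨y, hy⟩ := by
  constructor
  · rintro (⟨_, hy, h⟩ | ⟨h, -⟩ | ⟨h, h'⟩)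
    · exact ⟨hy, h⟩
    · exact absurd h hx
    · exact absurd (h' ▸ (f ⟨y, h⟩).2) hxW
  · rintro ⟨hy, h⟩
    exact Or.inl ⟨hx, hy, h⟩

theorem isPendant_attach_congr {v : α} (hv : v ∉ W) (f' : {x // x ∈ S} → {x // x ∈ W}) :
    IsPendant W (attach hSW H f) v ↔ IsPendant W (attach hSW H f') v := by
  by_cases hS : v ∈ S
  · exact iff_of_true (isPendant_attach hS) (isPendant_attach hS)
  · simp only [IsPendant, attach_adj_of_not_mem hS hv]

open scoped Classical in
/-- The retraction of the vertices of `attach hSW H f` onto those of `H`. -/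
noncomputable def retract (hSW : Disjoint S W) (f : {x // x ∈ S} → {x // x ∈ W}) (x : α) :
    {x // x ∉ S} :=
  if hx : x ∈ S then ⟨f ⟨x, hx⟩, Finset.disjoint_right.1 hSW (f ⟨x, hx⟩).2⟩ else ⟨x, hx⟩

theorem retract_of_mem {x : α} (hx : x ∈ S) : (retract hSW f x : α) = f ⟨x, hx⟩ := by
  simp [retract, hx]

theorem retract_coe (x : {x // x ∉ S}) : retract hSW f x = x := by
  simp [retract, x.2]

theorem attach_adj_retract {x y : α} (h : (attach hSW H f).Adj x y) :
    retract hSW f x = retract hSW f y ∨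
      ∃ (hx : x ∉ S) (hy : y ∉ S), H.Adj ⟨x, hx⟩ ⟨y, hy⟩ := by
  rcases h with h | ⟨hx, h⟩ | ⟨hy, h⟩
  · exact Or.inr h
  · subst h
    left
    rw [← retract_of_mem (hSW := hSW) hx, retract_coe]
  · subst h
    left
    rw [← retract_of_mem (hSW := hSW) hy, retract_coe]

theorem reachable_of_forall_adj {β γ : Type*} {G : SimpleGraph β} {K : SimpleGraph γ} (r : β → γ)
    (hr : ∀ x y, G.Adj x y → K.Reachable (r x) (r y)) {x y : β} (h : G.Reachable x y) :
    K.Reachable (r x) (r y) := by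
  obtain ⟨p⟩ := h
  induction p with
  | nil => exact .rfl
  | cons h _ ih => exact (hr _ _ h).trans ih

theorem connected_attach (hH : H.Connected) : (attach hSW H f).Connected := by
  have key (x y : {x // x ∉ S}) : (attach hSW H f).Reachable x y :=
    reachable_of_forall_adj Subtype.val (fun x y h => (attach_adj_coe.2 h).reachable)
      (hH.preconnected x y)
  have hret (x : α) : (attach hSW H f).Reachable x (retract hSW f x) := by
    by_cases hx : x ∈ S
    · exact ((attach_adj_of_mem hx).2 (retract_of_mem hx)).reachable
    · exact (retract_coe (hSW := hSW) (f := f) ⟨x, hx⟩).symm ▸ .rfl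
  have := hH.nonempty
  have : Nonempty α := this.map Subtype.val
  exact ⟨fun x y => (hret x).trans ((key _ _).trans (hret y).symm)⟩

theorem isTree_attach : (attach hSW H f).IsTree ↔ H.IsTree := by
  constructor
  · intro h
    have := h.connected.nonempty
    have : Nonempty {x // x ∉ S} := this.map (retract hSW f)
    refine ⟨⟨fun x y => ?_⟩,
      (h.isAcyclic.comap ⟨Subtype.val, fun h => attach_adj_coe.2 h⟩ Subtype.val_injective)⟩
    have := reachable_of_forall_adj (K := H) (retract hSW f) (fun x y h => ?_)
      (h.connected.preconnected (x : α) y)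
    · simpa only [retract_coe] using this
    · rcases attach_adj_retract h with h | ⟨hx, hy, h⟩
      · rw [h]
      · simpa [retract, hx, hy] using h.reachable
  · intro h
    refine ⟨connected_attach h.connected, ?_⟩
    rw [SimpleGraph.isAcyclic_iff_forall_adj_isBridge]
    have leaf {x y : α} (hx : x ∈ S) (hxy : (attach hSW H f).Adj x y) :
        (attach hSW H f).IsBridge s(x, y) := by
      rw [SimpleGraph.isBridge_iff]
      rintro ⟨p⟩
      cases p with
      | nil => exact hxy.ne rfl
      | cons h' _ =>
        rw [SimpleGraph.deleteEdges_adj, attach_adj_of_mem hx] at h'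
        rw [attach_adj_of_mem hx] at hxy
        exact h'.2 (by simp [h'.1, hxy])
    intro x y hxy
    rcases id hxy with ⟨hx, hy, hH⟩ | ⟨hx, -⟩ | ⟨hy, -⟩
    · rw [SimpleGraph.isBridge_iff]
      intro hr
      have hb := (SimpleGraph.isAcyclic_iff_forall_adj_isBridge.1 h.isAcyclic) hH
      rw [SimpleGraph.isBridge_iff] at hb
      apply hb
      have := reachable_of_forall_adj (K := H.deleteEdges {s(⟨x, hx⟩, ⟨y, hy⟩)})
        (retract hSW f) (fun a b hab => ?_) hr
      · simpa [retract, hx, hy] using this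
      · rw [SimpleGraph.deleteEdges_adj] at hab
        rcases attach_adj_retract hab.1 with h | ⟨ha, hb, h⟩
        · rw [h]
        · have hab2 : (H.deleteEdges {s(⟨x, hx⟩, ⟨y, hy⟩)}).Adj ⟨a, ha⟩ ⟨b, hb⟩ := by
            rw [SimpleGraph.deleteEdges_adj]
            refine ⟨h, fun h' => hab.2 ?_⟩
            simpa using h'
          simpa [retract, ha, hb] using hab2.reachable
    · exact leaf hx hxy
    · have := leaf hy hxy.symm
      rwa [Sym2.eq_swap] at this

theorem exists_eq_attach (hSW : Disjoint S W) {G : SimpleGraph α} (h : ∀ v ∈ S, IsPendant W G v) :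
    ∃ H f, attach hSW H f = G := by
  choose! w hw hadj using h
  refine ⟨G.comap Subtype.val, fun v => ⟨w v, hw v v.2⟩, ?_⟩
  ext x y
  by_cases hx : x ∈ S
  · rw [attach_adj_of_mem hx, hadj x hx]
  by_cases hy : y ∈ S
  · rw [SimpleGraph.adj_comm, attach_adj_of_mem hy, G.adj_comm, hadj y hy]
  · exact attach_adj_coe (x := ⟨x, hx⟩) (y := ⟨y, hy⟩)

theorem attach_injective (hSW : Disjoint S W) :
    Function.Injective fun p : SimpleGraph {x // x ∉ S} × ({x // x ∈ S} → {x // x ∈ W}) =>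
      attach hSW p.1 p.2 := by
  rintro ⟨H, f⟩ ⟨H', f'⟩ h
  have hA (x y : α) : (attach hSW H f).Adj x y ↔ (attach hSW H' f').Adj x y := by
    simp only at h
    rw [h]
  refine Prod.ext ?_ (funext fun v => Subtype.ext ?_)
  · ext x y
    simpa only [attach_adj_coe] using hA x y
  · simpa only [attach_adj_of_mem v.2, true_iff] using hA v (f v)

open scoped Classical in
/-- The finite set of spanning trees on the vertex set `α`. -/
noncomputable def trees (α : Type*) [Finite α] : Finset (SimpleGraph α) :=
  letI := Fintype.ofFinite (SimpleGraph α)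
  {G | G.IsTree}

@[simp]
theorem mem_trees [Finite α] {G : SimpleGraph α} : G ∈ trees α ↔ G.IsTree := by
  simp [trees]

open scoped Classical in
theorem sum_trees_pendant [Finite α] (hSW : Disjoint S W) (F : SimpleGraph α → ℝ) :
    ∑ G ∈ trees α with ∀ v ∈ S, IsPendant W G v, F G =
      ∑ H ∈ trees {x // x ∉ S}, ∑ f : {x // x ∈ S} → {x // x ∈ W}, F (attach hSW H f) := by
  rw [← Finset.sum_product']
  symm
  refine Finset.sum_bij (fun p _ => attach hSW p.1 p.2) ?_ ?_ ?_ ?_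
  · rintro ⟨H, f⟩ h
    simp only [mem_product, mem_univ, and_true, mem_trees] at h
    simp only [mem_filter, mem_trees]
    exact ⟨isTree_attach.2 h, fun v hv => isPendant_attach hv⟩
  · exact fun p _ q _ h => attach_injective hSW h
  · intro G hG
    simp only [mem_filter, mem_trees] at hG
    obtain ⟨H, f, rfl⟩ := exists_eq_attach hSW hG.2
    exact ⟨(H, f), by simpa using isTree_attach.1 hG.1, rfl⟩
  · exact fun _ _ => rfl

theorem card_trees_pendant [Finite α] (hSW : Disjoint S W)
    [DecidablePred fun G : SimpleGraph α => ∀ v ∈ S, IsPendant W G v] :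
    #{G ∈ trees α | ∀ v ∈ S, IsPendant W G v} = #(trees {x // x ∉ S}) * #W ^ #S := by
  classical
  have := sum_trees_pendant hSW (fun _ => 1)
  simp only [sum_const, nsmul_eq_mul, mul_one, card_univ, Fintype.card_fun,
    Fintype.card_coe] at this
  have h2 : (#{G ∈ trees α | ∀ v ∈ S, IsPendant W G v} : ℝ) =
    (#(trees {x // x ∉ S}) * #W ^ #S : ℕ) := by
    push_cast at this ⊢
    rw [← this]
    congr!
  exact_mod_cast h2

section Rectangle

/-- A set of graphs which, for a given colouring of the pairs of vertices, contains for all its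
members `G₁` and `G₂` the graph formed by the coloured edges of `G₁` and the uncoloured edges of
`G₂`. -/
def IsRectangle (c : α → α → Prop) (R : Set (SimpleGraph α)) : Prop :=
  ∀ G₁ ∈ R, ∀ G₂ ∈ R, ∃ M ∈ R, ∀ x y, M.Adj x y ↔ c x y ∧ G₁.Adj x y ∨ ¬ c x y ∧ G₂.Adj x y

variable {c : α → α → Prop} {R : Set (SimpleGraph α)} {q : ℝ}

theorem IsRectangle.color_eq (hR : IsRectangle c R) (htree : ∀ G ∈ R, G.IsTree)
    {f' : {x // x ∈ S} → {x // x ∈ W}}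
    (hf : attach hSW H f ∈ R) (hf' : attach hSW H f' ∈ R) (v : {x // x ∈ S})
    (hc : c v (f v)) : c v (f' v) := by
  by_contra hc'
  obtain ⟨M, hM, hadj⟩ := hR _ hf _ hf'
  have h₁ : M.Adj v (f v) := (hadj _ _).2 (Or.inl ⟨hc, (attach_adj_of_mem v.2).2 rfl⟩)
  have h₂ : M.Adj v (f' v) := (hadj _ _).2 (Or.inr ⟨hc', (attach_adj_of_mem v.2).2 rfl⟩)
  have hne : (f v : α) ≠ f' v := fun h => hc' (h ▸ hc)
  have hb := SimpleGraph.isAcyclic_iff_forall_adj_isBridge.1 (htree M hM).isAcyclic h₁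
  rw [SimpleGraph.isBridge_iff] at hb
  apply hb
  have h₃ : (M.deleteEdges {s((v : α), (f v : α))}).Adj v (f' v) := by
    rw [SimpleGraph.deleteEdges_adj]
    refine ⟨h₂, fun h => ?_⟩
    simp only [Set.mem_singleton_iff, Sym2.eq_iff, true_and] at h
    rcases h with h | h
    · exact hne h.symm
    · exact h₁.ne h.1
  refine h₃.reachable.trans ?_
  have hmem (w : {x // x ∈ W}) : (w : α) ∉ S := Finset.disjoint_right.1 hSW w.2
  refine reachable_of_forall_adj (G := H) Subtype.val (fun x y hxy => ?_)
    ((isTree_attach.1 (htree _ hf)).connected.preconnected ⟨f' v, hmem _⟩ ⟨f v, hmem _⟩)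
  refine SimpleGraph.Adj.reachable ?_
  rw [SimpleGraph.deleteEdges_adj]
  refine ⟨(hadj _ _).2 ?_, fun h => ?_⟩
  · simp only [attach_adj_coe, hxy, and_true]
    exact em _
  · simp only [Set.mem_singleton_iff, Sym2.eq_iff] at h
    rcases h with h | h
    · exact x.2 (h.1 ▸ v.2)
    · exact y.2 (h.2 ▸ v.2)

open scoped Classical in
theorem IsRectangle.card_attach_le (hR : IsRectangle c R) (htree : ∀ G ∈ R, G.IsTree)
    (hSW : Disjoint S W) (H : SimpleGraph {x // x ∉ S}) (hq : 0 ≤ q)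
    (hbal : ∀ v ∈ S, ∀ p : Prop, (#{w ∈ W | c v w ↔ p} : ℝ) ≤ q * #W) :
    (#{f : {x // x ∈ S} → {x // x ∈ W} | attach hSW H f ∈ R} : ℝ) ≤ (q * #W) ^ #S := by
  rcases Finset.eq_empty_or_nonempty
    {f : {x // x ∈ S} → {x // x ∈ W} | attach hSW H f ∈ R} with h | ⟨f₀, hf₀⟩
  · rw [h]
    simp only [card_empty, Nat.cast_zero]
    positivity
  · simp only [mem_filter, mem_univ, true_and] at hf₀
    have hsub : ({f : {x // x ∈ S} → {x // x ∈ W} | attach hSW H f ∈ R} : Finset _) ⊆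
        Fintype.piFinset fun v : {x // x ∈ S} => {w : {x // x ∈ W} | c v w ↔ c v (f₀ v)} := by
      intro f hf
      simp only [mem_filter, mem_univ, true_and] at hf
      simp only [Fintype.mem_piFinset, mem_filter, mem_univ, true_and]
      exact fun v => ⟨hR.color_eq htree hf hf₀ v, hR.color_eq htree hf₀ hf v⟩
    have hcard := Finset.card_le_card hsub
    rw [Fintype.card_piFinset] at hcard
    calc _ ≤ ((∏ v : {x // x ∈ S}, #{w : {x // x ∈ W} | c v w ↔ c v (f₀ v)} : ℕ) : ℝ) := by
          exact_mod_cast hcard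
      _ ≤ ∏ v : {x // x ∈ S}, q * #W := by
          rw [Nat.cast_prod]
          refine Finset.prod_le_prod (fun _ _ => by positivity) fun v _ => ?_
          refine le_trans ?_ (hbal v v.2 (c v (f₀ v)))
          rw [Nat.cast_le]
          refine Finset.card_le_card_of_injOn Subtype.val ?_ Subtype.val_injective.injOn
          intro w hw
          simpa using hw
      _ = _ := by simp

open scoped Classical in
/-- The vertices of `U` that are pendant in `G`, with neighbour in `W`. -/
noncomputable def pendants (U W : Finset α) (G : SimpleGraph α) : Finset α :=
  {v ∈ U | IsPendant W G v}

theorem subset_pendants {U : Finset α} {G : SimpleGraph α} (h : S ⊆ U) :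
    S ⊆ pendants U W G ↔ ∀ v ∈ S, IsPendant W G v := by
  simp only [pendants, subset_iff, mem_filter]
  exact ⟨fun h v hv => (h hv).2, fun h' v hv => ⟨h hv, h' v hv⟩⟩

open scoped Classical in
theorem IsRectangle.card_pendants_eq_le [Finite α] {U : Finset α} (hR : IsRectangle c R)
    (htree : ∀ G ∈ R, G.IsTree) (hUW : Disjoint U W) (hS : S ⊆ U) (hq : 0 ≤ q)
    (hbal : ∀ v ∈ U, ∀ p : Prop, (#{w ∈ W | c v w ↔ p} : ℝ) ≤ q * #W) :
    (#{G ∈ trees α | G ∈ R ∧ pendants U W G = S} : ℝ) ≤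
      q ^ #S * #{G ∈ trees α | pendants U W G = S} := by
  have hSW : Disjoint S W := hUW.mono_left hS
  have hcount (Q : SimpleGraph α → Prop) [DecidablePred Q] (hQ : ∀ G, Q G → pendants U W G = S) :
      (#{G ∈ trees α | Q G} : ℝ) = ∑ H ∈ trees {x // x ∉ S},
        ∑ f : {x // x ∈ S} → {x // x ∈ W}, if Q (attach hSW H f) then 1 else 0 := by
    rw [← sum_trees_pendant hSW (fun G => if Q G then 1 else 0), ← Finset.sum_filter,
      Finset.filter_filter, Finset.sum_const, nsmul_eq_mul, mul_one]
    congr 2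
    refine Finset.filter_congr fun G _ => ⟨fun h => ⟨?_, h⟩, fun h => h.2⟩
    exact (subset_pendants hS).1 (hQ G h).ge
  rw [hcount _ fun _ h => h.2, hcount _ fun _ h => h, Finset.mul_sum]
  refine Finset.sum_le_sum fun H _ => ?_
  by_cases hH : ∃ f, pendants U W (attach hSW H f) = S
  · obtain ⟨f₀, hf₀⟩ := hH
    have hall (f) : pendants U W (attach hSW H f) = S := by
      refine Eq.trans ?_ hf₀
      refine Finset.filter_congr fun v hv => ?_
      exact isPendant_attach_congr (Finset.disjoint_left.1 hUW hv) _
    simp only [hall, and_true, if_true]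
    rw [← Finset.sum_filter, Finset.sum_const, nsmul_eq_mul, mul_one]
    refine (hR.card_attach_le htree hSW H hq fun v hv => hbal v (hS hv)).trans_eq ?_
    simp [mul_pow]
  · push Not at hH
    simp [hH]

open scoped Classical in
theorem IsRectangle.card_le [Finite α] {U : Finset α} (hR : IsRectangle c R)
    (htree : ∀ G ∈ R, G.IsTree) (hUW : Disjoint U W) (hq : 0 ≤ q)
    (hbal : ∀ v ∈ U, ∀ p : Prop, (#{w ∈ W | c v w ↔ p} : ℝ) ≤ q * #W) :
    (#{G ∈ trees α | G ∈ R} : ℝ) ≤ ∑ G ∈ trees α, q ^ #(pendants U W G) := by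
  have hmaps (G : SimpleGraph α) : pendants U W G ∈ U.powerset := by simp [pendants]
  rw [Finset.card_eq_sum_card_fiberwise (f := pendants U W) (t := U.powerset)
    fun G _ => hmaps G, ← Finset.sum_fiberwise_of_maps_to (g := pendants U W) (t := U.powerset)
    fun G _ => hmaps G, Nat.cast_sum]
  refine Finset.sum_le_sum fun S hS => ?_
  rw [Finset.filter_filter]
  refine (hR.card_pendants_eq_le htree hUW (Finset.mem_powerset.1 hS) hq hbal).trans_eq ?_
  rw [Finset.sum_congr rfl fun G hG => by rw [(Finset.mem_filter.1 hG).2], Finset.sum_const,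
    nsmul_eq_mul, mul_comm]

end Rectangle

theorem sum_pow_card {β ι : Type*} [DecidableEq ι] (X : Finset β) (L : β → Finset ι)
    {U : Finset ι} (hL : ∀ x, L x ⊆ U) (q : ℝ) :
    ∑ x ∈ X, q ^ #(L x) = ∑ S ∈ U.powerset, (q - 1) ^ #S * #{x ∈ X | S ⊆ L x} := by
  have h (x : β) : q ^ #(L x) = ∑ S ∈ U.powerset, if S ⊆ L x then (q - 1) ^ #S else 0 := by
    rw [← Finset.sum_filter]
    have := Finset.sum_pow_mul_eq_add_pow (q - 1) 1 (L x)
    simp only [one_pow, mul_one, sub_add_cancel] at this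
    rw [← this]
    refine Finset.sum_congr ?_ fun _ _ => rfl
    ext S
    simp only [mem_powerset, mem_filter]
    exact ⟨fun h => ⟨h.trans (hL x), h⟩, fun h => h.2⟩
  simp_rw [h]
  rw [Finset.sum_comm]
  refine Finset.sum_congr rfl fun S _ => ?_
  rw [← Finset.sum_filter, Finset.sum_const, nsmul_eq_mul, mul_comm]

theorem forall_of_reachable {G : SimpleGraph α} (P : α → Prop)
    (hP : ∀ x y, G.Adj x y → P x → P y) {x y : α} (h : G.Reachable x y) (hx : P x) : P y := by
  obtain ⟨p⟩ := h
  induction p with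
  | nil => exact hx
  | cons h _ ih => exact ih (hP _ _ h hx)

theorem isPendant_compl_of_isTree [Fintype α] [DecidableEq α] {G : SimpleGraph α} (hG : G.IsTree)
    (hcard : 3 ≤ Fintype.card α) (h : ∀ v ∈ S, IsPendant univ G v) {v : α} (hv : v ∈ S) :
    IsPendant Sᶜ G v := by
  obtain ⟨w, -, hw⟩ := h v hv
  refine ⟨w, ?_, hw⟩
  rw [mem_compl]
  intro hwS
  obtain ⟨w', -, hw'⟩ := h w hwS
  have hvw' : v = w' := (hw' v).1 ((hw w).2 rfl).symm
  subst hvw'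
  obtain ⟨z, hz⟩ : ∃ z, z ∉ ({v, w} : Finset α) := by
    by_contra! hall
    have := Finset.card_le_card (fun z _ => hall z : univ ⊆ ({v, w} : Finset α))
    rw [card_univ] at this
    have := Finset.card_le_two (a := v) (b := w)
    omega
  refine hz (forall_of_reachable (· ∈ ({v, w} : Finset α)) (fun x y hxy hx => ?_)
    (hG.connected.preconnected v z) (by simp))
  simp only [mem_insert, mem_singleton] at hx ⊢
  rcases hx with rfl | rfl
  · exact Or.inr ((hw y).1 hxy)
  · exact Or.inl ((hw' y).1 hxy)

theorem exists_isPendant_of_isTree [Fintype α] [Nontrivial α] {G : SimpleGraph α}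
    (hG : G.IsTree) : ∃ v, IsPendant univ G v := by
  classical
  obtain ⟨v, hv⟩ := hG.exists_vert_degree_one_of_nontrivial
  obtain ⟨w, hw, huniq⟩ := SimpleGraph.degree_eq_one_iff_existsUnique_adj.1 hv
  exact ⟨v, w, mem_univ _, fun x => ⟨huniq x, fun h => h ▸ hw⟩⟩

theorem card_trees_of_card_le_two [Fintype α] [Nonempty α] (h : Fintype.card α ≤ 2) :
    #(trees α) = 1 := by
  classical
  rw [Finset.card_eq_one]
  refine ⟨⊤, Finset.eq_singleton_iff_unique_mem.2 ⟨?_, fun G hG => ?_⟩⟩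
  · rw [mem_trees]
    exact ⟨SimpleGraph.connected_top, SimpleGraph.IsAcyclic.of_card_le_two (by simpa using h)⟩
  · rw [mem_trees] at hG
    ext x y
    rw [SimpleGraph.top_adj]
    refine ⟨fun h => h.ne, fun hxy => ?_⟩
    by_contra hadj
    refine hxy (forall_of_reachable (x = ·) (fun a b hab hxa => ?_)
      (hG.connected.preconnected x y) rfl)
    subst hxa
    by_contra hxb
    have hyb : y ≠ b := by
      rintro rfl
      exact hadj hab
    have := Finset.card_le_univ ({x, y, b} : Finset α)
    rw [Finset.card_eq_three.2 ⟨x, y, b, hxy, hxb, hyb, rfl⟩] at this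
    omega

/-- The elements that are not values of `f`. -/
def missing {ι : Type*} [Fintype α] [DecidableEq α] [Fintype ι] (f : ι → α) : Finset α :=
  {v | ∀ i, f i ≠ v}

@[simp]
theorem mem_missing {ι : Type*} [Fintype α] [DecidableEq α] [Fintype ι] {f : ι → α} {v : α} :
    v ∈ missing f ↔ ∀ i, f i ≠ v := by
  simp [missing]

theorem card_filter_subset_missing [Fintype α] [DecidableEq α] (n : ℕ) (S : Finset α) :
    #{f : Fin n → α | S ⊆ missing f} = (Fintype.card α - #S) ^ n := by
  have : ({f : Fin n → α | S ⊆ missing f} : Finset _) =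
      Fintype.piFinset fun _ => Sᶜ := by
    ext f
    simp only [mem_filter, mem_univ, true_and, subset_iff, mem_missing, Fintype.mem_piFinset,
      mem_compl]
    exact ⟨fun h i hi => h hi i rfl, fun h v hv i hi => h i (hi ▸ hv)⟩
  rw [this, Fintype.card_piFinset]
  simp [card_compl]

/-- **Cayley's formula** for the number of labelled trees. -/
theorem card_trees [Fintype α] [Nonempty α] :
    #(trees α) = Fintype.card α ^ (Fintype.card α - 2) := by
  obtain ⟨n, hn⟩ : ∃ n, Fintype.card α = n := ⟨_, rfl⟩
  induction n using Nat.strong_induction_on generalizing α with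
  | _ n ih =>
  classical
  rcases le_or_gt n 2 with h2 | h3
  · rw [card_trees_of_card_le_two (hn.trans_le h2), hn]
    have : 0 < n := hn ▸ Fintype.card_pos
    interval_cases n <;> rfl
  have : Nontrivial α := Fintype.one_lt_card_iff_nontrivial.1 (by omega)
  have hT := sum_pow_card (trees α) (pendants univ univ) (U := univ) (fun _ => subset_univ _) 0
  have hF := sum_pow_card (univ : Finset (Fin (n - 2) → α)) missing
    (U := univ) (fun _ => subset_univ _) 0
  rw [Finset.sum_eq_zero] at hT hF
  · replace hF := hT.symm.trans hF
    rw [powerset_univ, ← Finset.add_sum_erase _ _ (mem_univ ∅),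
      ← Finset.add_sum_erase _ _ (mem_univ ∅)] at hF
    rw [Finset.sum_congr (g := fun S => (0 - 1) ^ #S *
      (#{f : Fin (n - 2) → α | S ⊆ missing f} : ℝ)) rfl] at hF
    · rw [add_left_inj] at hF
      simp only [card_empty, pow_zero, one_mul, empty_subset, filter_true] at hF
      rw [Nat.cast_inj] at hF
      simpa [hn] using hF
    · intro S hS
      congr 2
      rw [card_filter_subset_missing, hn]
      have hS1 : 1 ≤ #S := Finset.card_pos.2 (Finset.nonempty_iff_ne_empty.2 (ne_of_mem_erase hS))
      have hSn : #S ≤ n := hn ▸ Finset.card_le_univ S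
      rw [show ({G ∈ trees α | S ⊆ pendants univ univ G} : Finset _) =
        {G ∈ trees α | ∀ v ∈ S, IsPendant Sᶜ G v} from ?_, card_trees_pendant disjoint_compl_right,
        card_compl, hn]
      · rcases hSn.eq_or_lt with h | h
        · rw [h, Nat.sub_self, zero_pow (by omega), zero_pow (by omega), mul_zero]
        · have hcard : Fintype.card {x // x ∉ S} = n - #S := by
            rw [Fintype.card_subtype_compl, hn, Fintype.card_coe]
          have : Nonempty {x // x ∉ S} := Fintype.card_pos_iff.1 (by omega)
          rw [ih (n - #S) (by omega) hcard, hcard, ← pow_add]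
          rcases (show n - #S = 1 ∨ 2 ≤ n - #S by omega) with h1 | h1
          · simp [h1]
          · congr 1
            omega
      · refine Finset.filter_congr fun G hG => ?_
        rw [mem_trees] at hG
        rw [subset_pendants (subset_univ _)]
        refine ⟨fun h v hv => isPendant_compl_of_isTree hG (by omega) h hv, fun h v hv => ?_⟩
        obtain ⟨w, -, hw⟩ := h v hv
        exact ⟨w, mem_univ _, hw⟩
  · intro f _
    refine zero_pow (Finset.card_pos.2 ?_).ne'
    have : ¬ Function.Surjective f := fun h => by
      have := Fintype.card_le_of_surjective f h
      rw [Fintype.card_fin] at this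
      omega
    simp only [Function.Surjective, not_forall, not_exists] at this
    obtain ⟨v, hv⟩ := this
    exact ⟨v, by simpa using hv⟩
  · intro G hG
    refine zero_pow (Finset.card_pos.2 ?_).ne'
    obtain ⟨v, hv⟩ := exists_isPendant_of_isTree (mem_trees.1 hG)
    exact ⟨v, by simpa [pendants] using hv⟩

/-- The expected value of `γ ^ X`, where `X` is the number of elements of a given `k`-element
subset of an `m`-element set that are missed by `n` independent uniform samples. -/
noncomputable def missingGF (m γ : ℝ) : ℕ → ℕ → ℝ
  | 0, k => γ ^ k
  | n + 1, k => (1 - k / m) * missingGF m γ n k + k / m * missingGF m γ n (k - 1)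

theorem sum_pow_card_missing [Fintype α] [DecidableEq α] [Nonempty α] (γ : ℝ) (n : ℕ)
    (U : Finset α) :
    ∑ f : Fin n → α, γ ^ #(U ∩ missing f) =
      (Fintype.card α : ℝ) ^ n * missingGF (Fintype.card α) γ n #U := by
  have hm : (Fintype.card α : ℝ) ≠ 0 := by exact_mod_cast Fintype.card_ne_zero
  induction n generalizing U with
  | zero =>
    have (f : Fin 0 → α) : U ∩ missing f = U := by
      ext
      simp
    simp [missingGF, this]
  | succ n ih =>
    have hcons (y : α) (f : Fin n → α) :
        U ∩ missing (Fin.cons y f : Fin (n + 1) → α) = U.erase y ∩ missing f := by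
      ext v
      simp only [mem_inter, mem_missing, Fin.forall_fin_succ, Fin.cons_zero, Fin.cons_succ,
        mem_erase]
      tauto
    rw [← (Fin.consEquiv fun _ : Fin (n + 1) => α).sum_comp, Fintype.sum_prod_type]
    change ∑ y, ∑ f : Fin n → α, γ ^ #(U ∩ missing (Fin.cons y f : Fin (n + 1) → α)) = _
    simp only [hcons, ih]
    rw [← Finset.sum_add_sum_compl U, Finset.sum_congr rfl fun y hy => by rw [card_erase_of_mem hy],
      Finset.sum_congr (s₁ := Uᶜ) rfl fun y hy => by rw [erase_eq_of_notMem (mem_compl.1 hy)],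
      Finset.sum_const, Finset.sum_const, card_compl, nsmul_eq_mul, nsmul_eq_mul,
      Nat.cast_sub (card_le_univ U), missingGF]
    field_simp
    ring

section missingGF

variable {m γ : ℝ}

theorem missingGF_nonneg (hm : 0 < m) (hγ : 0 ≤ γ) (n k : ℕ) (hk : k ≤ m) :
    0 ≤ missingGF m γ n k := by
  induction n generalizing k with
  | zero => exact pow_nonneg hγ k
  | succ n ih =>
    have h₁ : (k : ℝ) / m ≤ 1 := (div_le_one hm).2 hk
    have h₂ := ih k hk
    have h₃ := ih (k - 1) (le_trans (by exact_mod_cast Nat.sub_le k 1) hk)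
    have h₄ : 0 ≤ (k : ℝ) / m := by positivity
    have h₅ : 0 ≤ 1 - (k : ℝ) / m := by linarith
    rw [missingGF]
    positivity

theorem missingGF_succ_le (hm : 1 ≤ m) (hγ : 0 ≤ γ) (hγ1 : γ ≤ 1) (n k : ℕ)
    (hk : (k + 1 : ℕ) ≤ m) :
    missingGF m γ n (k + 1) ≤ (1 - (1 - γ) * (1 - 1 / m) ^ n) * missingGF m γ n k := by
  have hm0 : 0 < m := by linarith
  induction n generalizing k with
  | zero => simp [missingGF, pow_succ, mul_comm]
  | succ n ih =>
    set p := (1 - γ) * (1 - 1 / m) ^ n with hp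
    have hm1 : 1 / m ≤ 1 := (div_le_one hm0).2 hm
    have hp0 : 0 ≤ p := mul_nonneg (by linarith) (pow_nonneg (by linarith) n)
    have hpsucc : (1 - γ) * (1 - 1 / m) ^ (n + 1) = p * (1 - 1 / m) := by rw [hp]; ring
    rw [hpsucc]
    have h₁ := ih k hk
    have hkm : (k : ℝ) + 1 ≤ m := by exact_mod_cast hk
    set t := 1 / m with ht
    have ht0 : 0 ≤ t := by positivity
    have hdiv (x : ℝ) : x / m = x * t := by rw [ht]; ring
    have hkt : ((k : ℝ) + 1) * t ≤ 1 := by rw [← hdiv]; exact (div_le_one hm0).2 hkm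
    rw [missingGF, missingGF, Nat.add_sub_cancel, hdiv, hdiv]
    push_cast
    have h₂ := mul_le_mul_of_nonneg_left h₁ (sub_nonneg.2 hkt)
    rcases k with _ | k
    · simp only [Nat.cast_zero] at *
      nlinarith
    · have h₃ := ih k (le_trans (by exact_mod_cast Nat.le_succ _) hk)
      have h₄ := missingGF_nonneg hm0 hγ n k (by push_cast at hkm; linarith)
      rw [Nat.add_sub_cancel]
      push_cast at *
      have h₅ : missingGF m γ n (k + 1) ≤ missingGF m γ n k := by nlinarith
      have h₆ : 0 ≤ p * t * (((k : ℝ) + 1) * t) *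
          (missingGF m γ n k - missingGF m γ n (k + 1)) :=
        mul_nonneg (by positivity) (sub_nonneg.2 h₅)
      have h₇ := mul_le_mul_of_nonneg_left h₃ (by positivity : 0 ≤ ((k : ℝ) + 1) * t)
      nlinarith

theorem missingGF_le_pow (hm : 1 ≤ m) (hγ : 0 ≤ γ) (hγ1 : γ ≤ 1) (n k : ℕ) (hk : k ≤ m) :
    missingGF m γ n k ≤ (1 - (1 - γ) * (1 - 1 / m) ^ n) ^ k := by
  have hm1 : 1 / m ≤ 1 := (div_le_one (by linarith)).2 hm
  have hp1 : (1 - 1 / m) ^ n ≤ 1 :=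
    pow_le_one₀ (by linarith) (by linarith [show 0 ≤ 1 / m by positivity])
  have hp0 : 0 ≤ (1 - 1 / m) ^ n := pow_nonneg (by linarith) n
  have hr : 0 ≤ 1 - (1 - γ) * (1 - 1 / m) ^ n := by nlinarith
  induction k with
  | zero =>
    have (n : ℕ) : missingGF m γ n 0 = 1 := by
      induction n with
      | zero => simp [missingGF]
      | succ n ih => simp [missingGF, ih]
    simp [this]
  | succ k ih =>
    rw [pow_succ']
    exact (missingGF_succ_le hm hγ hγ1 n k hk).trans
      (mul_le_mul_of_nonneg_left (ih (le_trans (by exact_mod_cast Nat.le_succ _) hk)) hr)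

end missingGF

section Model

variable [Fintype α] [DecidableEq α] {U : Finset α}

/-- The vertices of `U` that the first map sends out of `U` and that neither map takes as a
value. For uniformly random maps this has the same distribution as the set of vertices of `U`
that are pendant in a uniformly random tree, with neighbour outside `U`. -/
def modelPendants {n : ℕ} (p : ({x // x ∈ U} → α) × (Fin n → α)) : Finset α :=
  ({v | p.1 v ∉ U ∧ (∀ i, p.1 i ≠ v) ∧ (v : α) ∈ missing p.2} : Finset {x // x ∈ U}).map
    (Function.Embedding.subtype _)

theorem modelPendants_subset {n : ℕ} (p : ({x // x ∈ U} → α) × (Fin n → α)) :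
    modelPendants p ⊆ U := by
  intro v hv
  simp only [modelPendants, mem_map, Function.Embedding.subtype_apply] at hv
  obtain ⟨w, -, rfl⟩ := hv
  exact w.2

theorem card_filter_subset_modelPendants {n : ℕ} (hS : S ⊆ U) :
    #{p : ({x // x ∈ U} → α) × (Fin n → α) | S ⊆ modelPendants p} =
      #Uᶜ ^ #S * (Fintype.card α - #S) ^ (#U - #S) * (Fintype.card α - #S) ^ n := by
  have : ({p : ({x // x ∈ U} → α) × (Fin n → α) | S ⊆ modelPendants p} : Finset _) =
      (Fintype.piFinset fun v : {x // x ∈ U} => if (v : α) ∈ S then Uᶜ else Sᶜ) ×ˢ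
        Fintype.piFinset fun _ => Sᶜ := by
    ext p
    simp only [mem_filter, mem_univ, true_and, mem_product, Fintype.mem_piFinset, mem_compl]
    constructor
    · intro h
      have h' (v : α) (hv : v ∈ S) : p.1 ⟨v, hS hv⟩ ∉ U ∧ (∀ i, p.1 i ≠ v) ∧ ∀ i, p.2 i ≠ v := by
        have := h hv
        simp only [modelPendants, mem_map, Function.Embedding.subtype_apply, mem_filter, mem_univ,
          true_and, mem_missing] at this
        obtain ⟨w, hw, rfl⟩ := this
        exact hw
      refine ⟨fun v => ?_, fun i hi => (h' _ hi).2.2 i rfl⟩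
      split_ifs with hv
      · exact mem_compl.2 (h' v hv).1
      · exact mem_compl.2 fun hi => (h' _ hi).2.1 v rfl
    · rintro ⟨h₁, h₂⟩ v hv
      simp only [modelPendants, mem_map, Function.Embedding.subtype_apply, mem_filter, mem_univ,
          true_and, mem_missing]
      refine ⟨⟨v, hS hv⟩, ⟨?_, fun i hi => ?_, fun i hi => h₂ i (hi ▸ hv)⟩, rfl⟩
      · simpa [hv] using h₁ ⟨v, hS hv⟩
      · have := h₁ i
        simp only at hi
        rw [hi] at this
        split_ifs at this
        · exact mem_compl.1 this (hS hv)
        · exact mem_compl.1 this hv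
  rw [this, card_product, Fintype.card_piFinset, Fintype.card_piFinset]
  simp only [apply_ite Finset.card]
  rw [Finset.prod_coe_sort U fun v => if v ∈ S then #Uᶜ else #Sᶜ, Finset.prod_ite, prod_const,
    prod_const, prod_const, Finset.filter_mem_eq_inter, Finset.inter_eq_right.2 hS,
    Finset.filter_notMem_eq_sdiff, card_sdiff_of_subset hS, card_compl S, card_univ,
    Fintype.card_fin]

theorem sum_pow_card_pendants (hU : 2 ≤ #Uᶜ) (q : ℝ) :
    ∑ G ∈ trees α, q ^ #(pendants U Uᶜ G) =
      ∑ p : ({x // x ∈ U} → α) × (Fin (#Uᶜ - 2) → α), q ^ #(modelPendants p) := by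
  classical
  rw [sum_pow_card (trees α) (pendants U Uᶜ) (U := U) (fun _ => Finset.filter_subset _ _),
    sum_pow_card univ _ (U := U) modelPendants_subset]
  refine Finset.sum_congr rfl fun S hS => ?_
  rw [mem_powerset] at hS
  have hSU := card_le_card hS
  have hcU := card_compl U
  have hUn := card_le_univ U
  have hcard : Fintype.card {x // x ∉ S} = Fintype.card α - #S := by
    rw [Fintype.card_subtype_compl, Fintype.card_coe]
  have : Nonempty {x // x ∉ S} := Fintype.card_pos_iff.1 (by omega)
  simp only [subset_pendants hS]
  rw [card_trees_pendant (disjoint_compl_right.mono_left hS), card_trees, hcard,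
    card_filter_subset_modelPendants hS, mul_assoc, ← pow_add, mul_comm (#Uᶜ ^ #S)]
  congr 4
  omega

theorem pow_card_modelPendants_le {q : ℝ} (hq : 0 < q) (hq1 : q ≤ 1) {n : ℕ}
    (p : ({x // x ∈ U} → α) × (Fin n → α)) :
    q ^ #(modelPendants p) ≤
      ∏ v, if p.1 v ∈ U then q⁻¹ else if (v : α) ∈ missing p.2 then q else 1 := by
  rw [Finset.prod_ite, Finset.prod_ite, prod_const, prod_const, prod_const_one, mul_one, inv_pow,
    inv_mul_eq_div, le_div_iff₀ (by positivity), ← pow_add]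
  refine pow_le_pow_of_le_one hq.le hq1 ?_
  rw [modelPendants, card_map]
  set D : Finset {x // x ∈ U} := {v | p.1 v ∈ U}
  calc _ ≤ #(({v | p.1 v ∉ U ∧ (∀ i, p.1 i ≠ v) ∧ (v : α) ∈ missing p.2} :
        Finset {x // x ∈ U}) ∪
          ({v | ∃ i ∈ D, p.1 i = v} : Finset {x // x ∈ U})) := by
        refine card_le_card fun v hv => ?_
        simp only [mem_filter, mem_univ, true_and, mem_union] at hv ⊢
        by_cases h : ∀ i, p.1 i ≠ v
        · exact Or.inl ⟨hv.1, h, hv.2⟩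
        · push Not at h
          obtain ⟨i, hi⟩ := h
          exact Or.inr ⟨i, by simp [D, hi], hi⟩
    _ ≤ _ := (card_union_le _ _).trans (Nat.add_le_add_left ?_ _)
  rw [← card_map (Function.Embedding.subtype _)]
  refine (card_le_card fun v hv => ?_).trans (card_image_le (s := D) (f := p.1))
  simp only [mem_map, mem_filter, mem_univ, true_and, Function.Embedding.subtype_apply] at hv
  obtain ⟨w, ⟨i, hi, hiw⟩, rfl⟩ := hv
  exact mem_image.2 ⟨i, hi, hiw⟩

theorem sum_pow_card_pendants_le (hU : 2 ≤ #Uᶜ) {q : ℝ} (hq : 0 < q) (hq1 : q ≤ 1) :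
    ∑ G ∈ trees α, q ^ #(pendants U Uᶜ G) ≤ (Fintype.card α : ℝ) ^ (#Uᶜ - 2) *
      (#U * q⁻¹ + #Uᶜ -
        #Uᶜ * (1 - q) * (1 - 1 / (Fintype.card α : ℝ)) ^ (#Uᶜ - 2)) ^ #U := by
  have hw : (0 : ℝ) < #Uᶜ := by exact_mod_cast (by omega : 0 < #Uᶜ)
  have hne : Nonempty α := by
    obtain ⟨x, -⟩ := Finset.card_pos.1 (by omega : 0 < #Uᶜ)
    exact ⟨x⟩
  set B : ℝ := #U * q⁻¹ + #Uᶜ with hB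
  set A : ℝ := #U * q⁻¹ + #Uᶜ * q with hA
  have hB0 : 0 < B := by positivity
  have hA0 : 0 ≤ A := by positivity
  have hAB : A ≤ B := by rw [hA, hB]; nlinarith
  have hprod (p₂ : Fin (#Uᶜ - 2) → α) :
      ∑ p₁ : {x // x ∈ U} → α,
        ∏ v, (if p₁ v ∈ U then q⁻¹ else if (v : α) ∈ missing p₂ then q else 1) =
      B ^ #U * (A / B) ^ #(U ∩ missing p₂) := by
    have := Finset.prod_univ_sum (fun _ : {x // x ∈ U} => (univ : Finset α))
      fun v y => if y ∈ U then q⁻¹ else if (v : α) ∈ missing p₂ then q else 1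
    rw [Fintype.piFinset_univ] at this
    rw [← this]
    have hsum (v : α) : (∑ y, if y ∈ U then q⁻¹ else if v ∈ missing p₂ then q else 1) =
        B * if v ∈ missing p₂ then A / B else 1 := by
      rw [Finset.sum_ite, sum_const, sum_const, Finset.filter_mem_eq_inter, univ_inter,
        Finset.filter_notMem_eq_sdiff, ← compl_eq_univ_sdiff, nsmul_eq_mul, nsmul_eq_mul]
      split_ifs
      · rw [mul_div_cancel₀ _ hB0.ne']
      · rw [mul_one, mul_one]
    simp only [hsum]
    rw [Finset.prod_coe_sort U fun v => B * if v ∈ missing p₂ then A / B else 1,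
      Finset.prod_mul_distrib, prod_const, Finset.prod_ite, prod_const, prod_const_one, mul_one,
      Finset.filter_mem_eq_inter]
  calc _ ≤ ∑ p : ({x // x ∈ U} → α) × (Fin (#Uᶜ - 2) → α),
        ∏ v, (if p.1 v ∈ U then q⁻¹ else if (v : α) ∈ missing p.2 then q else 1) := by
        rw [sum_pow_card_pendants hU]
        exact Finset.sum_le_sum fun p _ => pow_card_modelPendants_le hq hq1 p
    _ = B ^ #U * ((Fintype.card α : ℝ) ^ (#Uᶜ - 2) *
        missingGF (Fintype.card α) (A / B) (#Uᶜ - 2) #U) := by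
        rw [Fintype.sum_prod_type_right]
        simp only [hprod]
        rw [← Finset.mul_sum, sum_pow_card_missing]
    _ ≤ B ^ #U * ((Fintype.card α : ℝ) ^ (#Uᶜ - 2) *
        (1 - (1 - A / B) * (1 - 1 / (Fintype.card α : ℝ)) ^ (#Uᶜ - 2)) ^ #U) := by
        gcongr
        refine missingGF_le_pow ?_ (by positivity) ((div_le_one hB0).2 hAB) _ _ ?_
        · exact_mod_cast Fintype.card_pos (α := α)
        · exact_mod_cast card_le_univ U
    _ = _ := by
        rw [mul_left_comm, ← mul_pow]
        congr 2
        field_simp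
        rw [hA, hB]
        ring

end Model

section Balanced

variable [Fintype α] [DecidableEq α] (K : SimpleGraph α) [DecidableRel K.Adj]

theorem card_mul_card_le_sum_degree {P Q : Finset α} (hPQ : Disjoint P Q) :
    #P * #Q ≤ ∑ v ∈ P, Kᶜ.degree v + ∑ w ∈ Q, K.degree w := by
  calc #P * #Q = ∑ v ∈ P, (#{w ∈ Q | ¬ K.Adj v w} + #{w ∈ Q | K.Adj v w}) := by
        rw [Finset.sum_congr rfl fun v _ => by
          rw [add_comm, Finset.card_filter_add_card_filter_not], sum_const, smul_eq_mul]
    _ = ∑ v ∈ P, #{w ∈ Q | ¬ K.Adj v w} + ∑ w ∈ Q, #{v ∈ P | K.Adj v w} := by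
        rw [Finset.sum_add_distrib]
        congr 1
        simp only [Finset.card_filter]
        exact Finset.sum_comm
    _ ≤ _ := by
        refine Nat.add_le_add (Finset.sum_le_sum fun v hv => ?_) (Finset.sum_le_sum fun w _ => ?_)
        · rw [← SimpleGraph.card_neighborFinset_eq_degree]
          refine card_le_card fun w hw => ?_
          rw [mem_filter] at hw
          rw [SimpleGraph.mem_neighborFinset, SimpleGraph.compl_adj]
          exact ⟨fun h => Finset.disjoint_left.1 hPQ hv (h ▸ hw.1), hw.2⟩
        · rw [← SimpleGraph.card_neighborFinset_eq_degree]
          refine card_le_card fun v hv => ?_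
          rw [mem_filter] at hv
          rw [SimpleGraph.mem_neighborFinset]
          exact hv.2.symm

theorem card_le_card_balanced_of_le (hm : 20 ≤ Fintype.card α)
    (hle : #{v | 10 * K.degree v < Fintype.card α} ≤ #{v | 10 * Kᶜ.degree v < Fintype.card α})
    (hsum : Fintype.card α * (Fintype.card α - 1 : ℝ) / 3 ≤ ∑ v, (Kᶜ.degree v : ℝ)) :
    Fintype.card α ≤
      20 * #{v | Fintype.card α ≤ 10 * K.degree v ∧ Fintype.card α ≤ 10 * Kᶜ.degree v} := by
  set m := Fintype.card α
  set P : Finset α := {v | 10 * Kᶜ.degree v < m} with hP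
  set Q : Finset α := {v | 10 * K.degree v < m} with hQ
  set Z : Finset α := {v | m ≤ 10 * K.degree v ∧ m ≤ 10 * Kᶜ.degree v} with hZ
  by_contra! hlt
  have hPQ : Disjoint P Q := by
    rw [Finset.disjoint_left]
    intro v hv hv'
    simp only [hP, hQ, mem_filter, mem_univ, true_and] at hv hv'
    have h₁ := K.degree_compl (v := v)
    have h₂ := K.degree_lt_card_verts v
    omega
  have hcover : m ≤ #P + #Q + #Z := by
    calc m = #(univ : Finset α) := card_univ.symm
      _ ≤ #(P ∪ Q ∪ Z) := by
        refine card_le_card fun v _ => ?_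
        simp only [hP, hQ, hZ, mem_union, mem_filter, mem_univ, true_and]
        omega
      _ ≤ _ := (card_union_le _ _).trans (Nat.add_le_add_right (card_union_le _ _) _)
  have hPm : #P + #Q ≤ m := by
    rw [← card_union_of_disjoint hPQ]
    exact card_le_univ _
  have hsumP : 10 * ∑ v ∈ P, Kᶜ.degree v ≤ #P * m := by
    rw [mul_sum, ← smul_eq_mul (#P)]
    refine Finset.sum_le_card_nsmul _ _ _ fun v hv => ?_
    simp only [hP, mem_filter, mem_univ, true_and] at hv
    exact hv.le
  have hsumQ : 10 * ∑ v ∈ Q, K.degree v ≤ #Q * m := by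
    rw [mul_sum, ← smul_eq_mul (#Q)]
    refine Finset.sum_le_card_nsmul _ _ _ fun v hv => ?_
    simp only [hQ, mem_filter, mem_univ, true_and] at hv
    exact hv.le
  have hsumPc : ∑ v ∈ Pᶜ, (Kᶜ.degree v : ℝ) ≤ (m - #P) * (m - 1) := by
    have := Finset.sum_le_card_nsmul Pᶜ (fun v => (Kᶜ.degree v : ℝ)) (m - 1) fun v _ => by
      have := Kᶜ.degree_lt_card_verts v
      rw [le_sub_iff_add_le]
      exact_mod_cast this
    rwa [card_compl, nsmul_eq_mul, Nat.cast_sub (card_le_univ P)] at this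
  have hPQ' := card_mul_card_le_sum_degree K hPQ
  rw [← Finset.sum_add_sum_compl P] at hsum
  have h₁ : (10 : ℝ) * ∑ v ∈ P, (Kᶜ.degree v : ℝ) ≤ #P * m := by exact_mod_cast hsumP
  have h₂ : (10 : ℝ) * (#P * #Q) ≤ m * (#P + #Q) := by
    have : 10 * (#P * #Q) ≤ m * (#P + #Q) := by linarith
    exact_mod_cast this
  have h₃ : (20 : ℝ) * #Z < m := by exact_mod_cast hlt
  have h₄ : (m : ℝ) ≤ #P + #Q + #Z := by exact_mod_cast hcover
  have h₅ : (#P : ℝ) + #Q ≤ m := by exact_mod_cast hPm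
  have h₆ : (#Q : ℝ) ≤ #P := by exact_mod_cast hle
  have h₇ : (20 : ℝ) ≤ m := by exact_mod_cast hm
  generalize (m : ℝ) = M at *
  generalize (#P : ℝ) = x at *
  generalize (#Q : ℝ) = y at *
  have hx : x ≤ 3 / 4 * M := by
    by_contra! hx
    nlinarith
  nlinarith [mul_nonneg (sub_nonneg.2 hx) (sub_nonneg.2 h₆)]

theorem card_le_card_balanced (hm : 20 ≤ Fintype.card α)
    (hsum : Fintype.card α * (Fintype.card α - 1 : ℝ) / 3 ≤ ∑ v, (K.degree v : ℝ))
    (hsum' : Fintype.card α * (Fintype.card α - 1 : ℝ) / 3 ≤ ∑ v, (Kᶜ.degree v : ℝ)) :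
    Fintype.card α ≤
      20 * #{v | Fintype.card α ≤ 10 * K.degree v ∧ Fintype.card α ≤ 10 * Kᶜ.degree v} := by
  rcases le_total #{v | 10 * K.degree v < Fintype.card α}
    #{v | 10 * Kᶜ.degree v < Fintype.card α} with h | h
  · exact card_le_card_balanced_of_le K hm h hsum'
  · have hdeg (v : α) : Kᶜᶜ.degree v = K.degree v := by
      rw [SimpleGraph.degree_compl, SimpleGraph.degree_compl]
      have := K.degree_lt_card_verts v
      omega
    have := card_le_card_balanced_of_le Kᶜ hm (by simpa only [hdeg] using h)
      (by simpa only [hdeg] using hsum)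
    simpa only [hdeg, and_comm] using this

open scoped Classical in
theorem card_filter_adj_iff_le {U : Finset α} (hU : 20 * #U ≤ Fintype.card α) {v : α}
    (hv : Fintype.card α ≤ 10 * K.degree v) (hv' : Fintype.card α ≤ 10 * Kᶜ.degree v) (p : Prop) :
    (#{w ∈ Uᶜ | K.Adj v w ↔ p} : ℝ) ≤ 19 / 20 * #Uᶜ := by
  have hsplit := Finset.card_filter_add_card_filter_not (s := Uᶜ) fun w => K.Adj v w ↔ p
  have hopp : Fintype.card α ≤ 10 * #{w | w ≠ v ∧ ¬ (K.Adj v w ↔ p)} := by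
    by_cases hp : p
    · refine hv'.trans (Nat.mul_le_mul_left _ ?_)
      rw [← SimpleGraph.card_neighborFinset_eq_degree]
      refine card_le_card fun w hw => ?_
      rw [SimpleGraph.mem_neighborFinset, SimpleGraph.compl_adj] at hw
      simp [hp, hw.1.symm, hw.2]
    · refine hv.trans (Nat.mul_le_mul_left _ ?_)
      rw [← SimpleGraph.card_neighborFinset_eq_degree]
      refine card_le_card fun w hw => ?_
      rw [SimpleGraph.mem_neighborFinset] at hw
      simp [hp, hw.ne', hw]
  have hle : #{w | w ≠ v ∧ ¬ (K.Adj v w ↔ p)} ≤ #{w ∈ Uᶜ | ¬ (K.Adj v w ↔ p)} + #U := by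
    refine (card_le_card fun w hw => ?_).trans (card_union_le _ _)
    simp only [mem_filter, mem_univ, true_and, mem_union, mem_compl] at hw ⊢
    tauto
  have hUc := card_compl U
  have : 20 * #{w ∈ Uᶜ | K.Adj v w ↔ p} ≤ 19 * #Uᶜ := by omega
  have : (20 * #{w ∈ Uᶜ | K.Adj v w ↔ p} : ℝ) ≤ 19 * #Uᶜ := by exact_mod_cast this
  linarith

end Balanced

theorem one_third_le_one_sub_inv_pow {m n : ℕ} (hm : 2 ≤ m) (hn : n ≤ m - 1) :
    (1 / 3 : ℝ) ≤ (1 - 1 / (m : ℝ)) ^ n := by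
  have hm' : (2 : ℝ) ≤ m := by exact_mod_cast hm
  have h1 : 1 / (m : ℝ) ≤ 1 := (div_le_one (by linarith)).2 (by linarith)
  have hpos : (0 : ℝ) < m - 1 := by linarith
  calc (1 / 3 : ℝ) ≤ Real.exp (-1) := by
        rw [Real.exp_neg, one_div]
        exact inv_anti₀ (Real.exp_pos 1) (by linarith [Real.exp_one_lt_d9])
    _ = Real.exp (-(1 / (m - 1 : ℝ))) ^ (m - 1) := by
        rw [← Real.exp_nat_mul, Nat.cast_sub (by omega)]
        congr 1
        push_cast
        field_simp
    _ ≤ (1 - 1 / (m : ℝ)) ^ (m - 1) := by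
        refine pow_le_pow_left₀ (Real.exp_pos _).le ?_ _
        rw [Real.exp_neg, show 1 - 1 / (m : ℝ) = (1 / (m - 1 : ℝ) + 1)⁻¹ by field_simp; ring]
        exact inv_anti₀ (by positivity) (Real.add_one_le_exp _)
    _ ≤ _ := pow_le_pow_of_le_one (by linarith)
        (by linarith [show 0 ≤ 1 / (m : ℝ) by positivity]) hn

theorem pow_le_two_rpow {m u : ℕ} (hu : m ≤ 40 * u) :
    (99 / 100 : ℝ) ^ u ≤ (2 : ℝ) ^ (-(m : ℝ) / 15120) := by
  have h : (99 / 100 : ℝ) ≤ 2 ^ (-(1 / 378) : ℝ) := by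
    rw [← pow_le_pow_iff_left₀ (by norm_num) (by positivity) (by norm_num : 378 ≠ 0),
      ← Real.rpow_natCast (2 ^ (-(1 / 378) : ℝ)), ← Real.rpow_mul (by norm_num)]
    calc (99 / 100 : ℝ) ^ 378 ≤ (99 / 100) ^ 70 :=
          pow_le_pow_of_le_one (by norm_num) (by norm_num) (by norm_num)
      _ ≤ 1 / 2 := by norm_num
      _ = _ := by norm_num
  calc (99 / 100 : ℝ) ^ u ≤ (2 ^ (-(1 / 378) : ℝ)) ^ u := pow_le_pow_left₀ (by norm_num) h u
    _ = 2 ^ (-(1 / 378) * u : ℝ) := by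
        rw [← Real.rpow_natCast, ← Real.rpow_mul (by norm_num)]
    _ ≤ _ := by
        refine Real.rpow_le_rpow_of_exponent_le (by norm_num) ?_
        have : (m : ℝ) ≤ 40 * u := by exact_mod_cast hu
        linarith

/-- A rectangle of spanning trees is an exponentially small fraction of all spanning trees. -/
theorem IsRectangle.card_le_two_rpow [Fintype α] [DecidableEq α] {K : SimpleGraph α}
    [DecidableRel K.Adj] {R : Set (SimpleGraph α)} [DecidablePred (· ∈ R)]
    (hR : IsRectangle K.Adj R) (htree : ∀ G ∈ R, G.IsTree) (hm : 20 ≤ Fintype.card α)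
    (hsum : Fintype.card α * (Fintype.card α - 1 : ℝ) / 3 ≤ ∑ v, (K.degree v : ℝ))
    (hsum' : Fintype.card α * (Fintype.card α - 1 : ℝ) / 3 ≤ ∑ v, (Kᶜ.degree v : ℝ)) :
    (#{G ∈ trees α | G ∈ R} : ℝ) ≤
      (2 : ℝ) ^ (-(Fintype.card α : ℝ) / 15120) * #(trees α) := by
  have : Nonempty α := Fintype.card_pos_iff.1 (by omega)
  have hbal := card_le_card_balanced K hm hsum hsum'
  obtain ⟨U, hUsub, hU⟩ := Finset.exists_subset_card_eq
    (show Fintype.card α / 20 ≤ _ from Nat.div_le_of_le_mul hbal)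
  have hUc := card_compl U
  have hrect := hR.card_le htree (U := U) (W := Uᶜ) (q := 19 / 20) disjoint_compl_right
    (by norm_num) fun v hv p => by
      have := hUsub hv
      rw [mem_filter] at this
      convert card_filter_adj_iff_le K (by omega : 20 * #U ≤ _) this.2.1 this.2.2 p
  have hsumle := sum_pow_card_pendants_le (U := U) (by omega) (q := 19 / 20) (by norm_num)
    (by norm_num)
  have hp := one_third_le_one_sub_inv_pow (m := Fintype.card α) (n := #Uᶜ - 2) (by omega)
    (by omega)
  have hp1 : (1 - 1 / (Fintype.card α : ℝ)) ^ (#Uᶜ - 2) ≤ 1 := by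
    have h20 : (20 : ℝ) ≤ Fintype.card α := by exact_mod_cast hm
    have : 1 / (Fintype.card α : ℝ) ≤ 1 := (div_le_one (by linarith)).2 (by linarith)
    exact pow_le_one₀ (by linarith)
      (by linarith [show 0 ≤ 1 / (Fintype.card α : ℝ) by positivity])
  have hexp := pow_le_two_rpow (m := Fintype.card α) (u := #U) (by omega)
  have hcardR : (#U : ℝ) + #Uᶜ = Fintype.card α := by exact_mod_cast card_add_card_compl U
  have hUR : (20 : ℝ) * #U ≤ Fintype.card α := by
    exact_mod_cast (by omega : 20 * #U ≤ Fintype.card α)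
  have hrect' : (#{G ∈ trees α | G ∈ R} : ℝ) ≤
      ∑ G ∈ trees α, (19 / 20 : ℝ) ^ #(pendants U Uᶜ G) := by convert hrect
  refine (hrect'.trans hsumle).trans ?_
  generalize (1 - 1 / (Fintype.card α : ℝ)) ^ (#Uᶜ - 2) = p at *
  calc _ ≤ (Fintype.card α : ℝ) ^ (#Uᶜ - 2) * (99 / 100 * Fintype.card α) ^ #U := by
        gcongr
        · nlinarith [Nat.cast_nonneg (α := ℝ) #U, Nat.cast_nonneg (α := ℝ) #Uᶜ]
        · nlinarith
    _ = (99 / 100) ^ #U * (Fintype.card α : ℝ) ^ (Fintype.card α - 2) := by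
        rw [mul_pow, mul_left_comm, ← pow_add]
        congr 2
        omega
    _ ≤ _ := by
        rw [card_trees, Nat.cast_pow]
        gcongr

section Encoding

variable {m : ℕ}

theorem graphOf_adj_coe (x : KmEdge m → Bool) (e : KmEdge m) :
    (graphOf x).Adj e.1.1 e.1.2 ↔ x e = true := by
  simp [graphOf, e.2, e.2.ne, e.2.le]

theorem eq_graphOf {G : SimpleGraph (Fin m)} {x : KmEdge m → Bool}
    (h : ∀ e : KmEdge m, G.Adj e.1.1 e.1.2 ↔ x e = true) : graphOf x = G := by
  ext u v
  rcases lt_trichotomy u v with huv | rfl | huv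
  · rw [graphOf_adj_coe x ⟨(u, v), huv⟩, h ⟨(u, v), huv⟩]
  · simp
  · rw [SimpleGraph.adj_comm, G.adj_comm, graphOf_adj_coe x ⟨(v, u), huv⟩, h ⟨(v, u), huv⟩]

theorem graphOf_bijective : Function.Bijective (graphOf (m := m)) := by
  classical
  refine ⟨fun x y hxy => funext fun e => ?_, fun G => ⟨fun e => decide (G.Adj e.1.1 e.1.2),
    eq_graphOf fun e => by simp⟩⟩
  rw [Bool.eq_iff_iff, ← graphOf_adj_coe, ← graphOf_adj_coe, hxy]

theorem compl_graphOf (x : KmEdge m → Bool) : (graphOf x)ᶜ = graphOf fun e => !x e :=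
  (eq_graphOf fun e => by simp [SimpleGraph.compl_adj, graphOf_adj_coe, e.2.ne]).symm

theorem sum_degree_graphOf (x : KmEdge m → Bool) [DecidableRel (graphOf x).Adj] :
    ∑ v, (graphOf x).degree v = 2 * #{e | x e = true} := by
  rw [SimpleGraph.sum_degrees_eq_twice_card_edges]
  congr 1
  symm
  refine card_bij (fun e _ => s(e.1.1, e.1.2)) (fun e he => ?_) (fun e _ e' _ hee => ?_) ?_
  · simpa [graphOf_adj_coe] using he
  · have h := e.2
    have h' := e'.2
    rcases Sym2.eq_iff.1 hee with ⟨h₁, h₂⟩ | ⟨h₁, h₂⟩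
    · exact Subtype.ext (Prod.ext h₁ h₂)
    · rw [h₁, h₂] at h
      exact absurd h h'.asymm
  · intro s
    induction s with | _ u v
    intro hs
    rw [SimpleGraph.mem_edgeFinset, SimpleGraph.mem_edgeSet] at hs
    rcases lt_or_gt_of_ne hs.ne with huv | huv
    · exact ⟨⟨(u, v), huv⟩, by simpa [graphOf_adj_coe x ⟨(u, v), huv⟩] using hs, rfl⟩
    · exact ⟨⟨(v, u), huv⟩, by simpa [graphOf_adj_coe x ⟨(v, u), huv⟩] using hs.symm,
        Sym2.eq_swap⟩

theorem two_mul_card_kmEdge : 2 * Fintype.card (KmEdge m) = m * (m - 1) := by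
  classical
  have htop : graphOf (fun _ : KmEdge m => true) = ⊤ := eq_graphOf fun e => by simp [e.2.ne]
  have hdeg (G : SimpleGraph (Fin m)) [DecidableRel G.Adj] (hG : G = ⊤) :
      ∑ v, G.degree v = m * (m - 1) := by
    subst hG
    have h (v : Fin m) : (⊤ : SimpleGraph (Fin m)).degree v = m - 1 := by
      convert SimpleGraph.complete_graph_degree v
      simp
    simp [h]
  simpa [hdeg _ htop] using (sum_degree_graphOf fun _ : KmEdge m => true).symm

theorem card_filter_trees (P : SimpleGraph (Fin m) → Prop) [DecidablePred P] :
    #{G ∈ trees (Fin m) | P G} =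
      Nat.card {x : KmEdge m → Bool // (graphOf x).IsTree ∧ P (graphOf x)} := by
  rw [← Nat.card_eq_finsetCard]
  refine (Nat.card_congr ((Equiv.ofBijective _ graphOf_bijective).subtypeEquiv fun x => ?_)).symm
  simp [mem_trees]

theorem isRectangle_graphOf (red : KmEdge m → Bool) {g h : (KmEdge m → Bool) → ℝ}
    (hg0 : ∀ x, 0 ≤ g x) (hh0 : ∀ x, 0 ≤ h x)
    (hgdep : ∀ x x', (∀ e, red e = true → x e = x' e) → g x = g x')
    (hhdep : ∀ x x', (∀ e, red e = false → x e = x' e) → h x = h x') :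
    IsRectangle (graphOf red).Adj {G | ∃ x, graphOf x = G ∧ 0 < g x * h x} := by
  rintro _ ⟨x₁, rfl, h₁⟩ _ ⟨x₂, rfl, h₂⟩
  refine ⟨_, ⟨fun e => if red e then x₁ e else x₂ e, rfl, ?_⟩, fun u v => ?_⟩
  · rw [hgdep _ x₁ fun e he => by simp [he], hhdep _ x₂ fun e he => by simp [he]]
    exact mul_pos (pos_of_mul_pos_left h₁ (hh0 _)) (pos_of_mul_pos_right h₂ (hg0 _))
  · have key (e : KmEdge m) : (graphOf fun e => if red e then x₁ e else x₂ e).Adj e.1.1 e.1.2 ↔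
        (graphOf red).Adj e.1.1 e.1.2 ∧ (graphOf x₁).Adj e.1.1 e.1.2 ∨
          ¬ (graphOf red).Adj e.1.1 e.1.2 ∧ (graphOf x₂).Adj e.1.1 e.1.2 := by
      simp only [graphOf_adj_coe]
      split_ifs with he <;> simp [he]
    rcases lt_trichotomy u v with huv | rfl | huv
    · exact key ⟨(u, v), huv⟩
    · simp
    · simpa only [SimpleGraph.adj_comm] using key ⟨(v, u), huv⟩

end Encoding

end SpanningTree

/-- Main lower-bound lemma: let `m ≥ 20` and color the `n = C(m,2)` edges of `K_m` red/blue
with between `n/3` and `2n/3` red edges.  If `g` is a nonnegative function of the red-edge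
indicators and `h` a nonnegative function of the blue-edge indicators such that `g·h` vanishes
at every `x` not encoding a spanning tree, then the fraction of spanning trees `T` of `K_m`
with `g(T)·h(T) > 0` is at most `2^{-m/15120}`. -/
theorem stmt_12 {m : ℕ} (hm : 20 ≤ m) (red : KmEdge m → Bool)
    (hr1 : ((Fintype.card (KmEdge m) : ℕ) : ℝ) / 3 ≤
      ((Finset.univ.filter (fun e : KmEdge m => red e = true)).card : ℝ))
    (hr2 : ((Finset.univ.filter (fun e : KmEdge m => red e = true)).card : ℝ) ≤
      2 * ((Fintype.card (KmEdge m) : ℕ) : ℝ) / 3)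
    (g h : (KmEdge m → Bool) → ℝ)
    (hg0 : ∀ x, 0 ≤ g x) (hh0 : ∀ x, 0 ≤ h x)
    (hgdep : ∀ x x', (∀ e, red e = true → x e = x' e) → g x = g x')
    (hhdep : ∀ x x', (∀ e, red e = false → x e = x' e) → h x = h x')
    (hzero : ∀ x, ¬ (graphOf x).IsTree → g x * h x = 0) :
    (Nat.card {x : KmEdge m → Bool // (graphOf x).IsTree ∧ 0 < g x * h x} : ℝ) ≤
      (2 : ℝ) ^ (-(m : ℝ) / 15120) *
        (Nat.card {x : KmEdge m → Bool // (graphOf x).IsTree} : ℝ) := by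
  classical
  have hcard : (2 : ℝ) * Fintype.card (KmEdge m) = m * (m - 1) := by
    rw [← Nat.cast_pred (by omega)]
    exact_mod_cast SpanningTree.two_mul_card_kmEdge (m := m)
  have hsplit := Finset.card_filter_add_card_filter_not (s := Finset.univ)
    fun e : KmEdge m => red e = true
  rw [Finset.card_univ, ← @Nat.cast_inj ℝ, Nat.cast_add] at hsplit
  have hred : ∑ v, ((graphOf red).degree v : ℝ) =
      2 * (Finset.univ.filter fun e : KmEdge m => red e = true).card := by
    exact_mod_cast SpanningTree.sum_degree_graphOf red
  have hblue : ∑ v, ((graphOf red)ᶜ.degree v : ℝ) =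
      2 * (Finset.univ.filter fun e : KmEdge m => ¬ red e = true).card := by
    have := SpanningTree.sum_degree_graphOf fun e => !red e
    simp only [Bool.not_eq_true', ← Bool.not_eq_true] at this
    rw [← Nat.cast_sum]
    norm_cast
    rw [← this]
    congr! 2
    exact SpanningTree.compl_graphOf red
  have hmain := (SpanningTree.isRectangle_graphOf red hg0 hh0 hgdep hhdep).card_le_two_rpow
    (fun G hG => by
      obtain ⟨x, rfl, hx⟩ := hG
      by_contra hT
      exact hx.ne' (hzero x hT))
    (by simpa using hm)
    (by rw [Fintype.card_fin, hred]; linarith)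
    (by rw [Fintype.card_fin, hblue]; linarith)
  have htrees := SpanningTree.card_filter_trees (m := m) fun _ => True
  simp only [Finset.filter_true, and_true] at htrees
  rw [SpanningTree.card_filter_trees, htrees, Fintype.card_fin] at hmain
  simpa [SpanningTree.graphOf_bijective.1.eq_iff] using hmain
end
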